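/- Under the bidirectional replacement 123 ↔ 1★2: (a) every reverse identity permutation rid_n is isolated; (b) two permutations π and σ, each having at least one element that is not a left-to-right minimum, are equivalent if and only if they agree in all three of the following statistics: the number of left-to-right minima, the position counted from the right of the rightmost non-left-to-right-minimum element, and the number of left-to-right minima whose value is less than the value of the smallest non-left-to-right-minimum element. Hence the equivalence classes are exactly the singletons {rid_n} together with one class for each attainable triple of statistics. -/

import Mathlib

/-!
Pattern-replacement equivalences between permutations of different lengths
(arXiv:1309.4802). A ★-pattern is encoded as a `List (Option ℕ)`, where `none`
is the placeholder ★ and `some k` an integer entry.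
-/

/-- A ★-pattern / star-string entry: `none` is ★, `some k` an integer `k`. -/
abbrev SPat := List (Option ℕ)

/-- The integer entries of a star-string, in order. -/
def ints (ρ : SPat) : List ℕ := ρ.filterMap id

/-- Two lists of naturals are order-isomorphic. -/
def OrdIso (u v : List ℕ) : Prop :=
  u.length = v.length ∧
  ∀ i j, i < u.length → j < u.length → (u.getD i 0 < u.getD j 0 ↔ v.getD i 0 < v.getD j 0)

/-- A valid string of distinct positive integers and ★'s. -/
def StarStr (ρ : SPat) : Prop := (ints ρ).Nodup ∧ ∀ k ∈ ints ρ, 0 < k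

/-- `r` (entry by entry) forms a copy of the ★-pattern `δ`: ★'s in the same
positions, and the integer entries order-isomorphic. -/
def IsCopy (r δ : SPat) : Prop :=
  r.length = δ.length ∧
  (∀ i, (r.getD i none = none ↔ δ.getD i none = none)) ∧
  OrdIso (ints r) (ints δ)

/-- `Repl a b ρ₁ ρ₂` : `ρ₂` is obtained from `ρ₁` by replacing an occurrence of `a`
as a (not necessarily contiguous) substring of `ρ₁` by `b`, entry by entry at the
same positions. -/
inductive Repl : SPat → SPat → SPat → SPat → Prop
  | nil : Repl [] [] [] []
  | keep {a b ρ₁ ρ₂} (x : Option ℕ) : Repl a b ρ₁ ρ₂ → Repl a b (x :: ρ₁) (x :: ρ₂)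
  | repl {a b ρ₁ ρ₂} (x y : Option ℕ) :
      Repl a b ρ₁ ρ₂ → Repl (x :: a) (y :: b) (x :: ρ₁) (y :: ρ₂)

/-- `π` is a permutation of `1, …, n` (as a list). -/
def IsPermList (π : List ℕ) : Prop := π.Perm (List.range' 1 π.length)

/-- `σ` is a result of the replacement `α → β` applied to the permutation `π`:
(1) `ρ₁` is `π` renumbered (order-isomorphically) with ★'s inserted anywhere;
(2) a substring `a` of `ρ₁` forming a copy of `α` is replaced (in place) by a
string `b` that is a copy of `β`, whose integers meet `ρ₁` only inside `a`, and
which agrees with `a` on the integer entries common to `α` and `β`;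
(3) dropping ★'s and renumbering gives the permutation `σ`. -/
def IsResult (α β : SPat) (π σ : List ℕ) : Prop :=
  ∃ ρ₁ ρ₂ a b : SPat,
    StarStr ρ₁ ∧ OrdIso π (ints ρ₁) ∧
    IsCopy a α ∧
    StarStr b ∧ IsCopy b β ∧
    (∀ k ∈ ints b, k ∈ ints ρ₁ → k ∈ ints a) ∧
    (∀ i j x, α.getD i none = some x → β.getD j none = some x →
      a.getD i none = b.getD j none) ∧
    Repl a b ρ₁ ρ₂ ∧
    IsPermList σ ∧ OrdIso (ints ρ₂) σ

/-- Equivalence under the bidirectional replacement `α ↔ β`: a finite sequence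
of `α → β` and `β → α` replacements. -/
def PermEquiv (α β : SPat) (π σ : List ℕ) : Prop :=
  Relation.ReflTransGen (fun τ υ => IsResult α β τ υ ∨ IsResult β α τ υ) π σ

/-- `π` is isolated under `α ↔ β`: no other permutation is equivalent to it. -/
def Isolated (α β : SPat) (π : List ℕ) : Prop :=
  ∀ σ : List ℕ, IsPermList σ → PermEquiv α β π σ → σ = π

/-- The identity permutation `1 2 ⋯ n`. -/
def idPerm (n : ℕ) : List ℕ := List.range' 1 n

/-- The reverse identity permutation `n (n-1) ⋯ 1`. -/
def ridPerm (n : ℕ) : List ℕ := (List.range' 1 n).reverse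

def pat123 : SPat := [some 1, some 2, some 3]
def pat132 : SPat := [some 1, some 3, some 2]
def patS32 : SPat := [none, some 3, some 2]
def pat3S2 : SPat := [some 3, none, some 2]
def pat32S : SPat := [some 3, some 2, none]
def patS31 : SPat := [none, some 3, some 1]
def pat3S1 : SPat := [some 3, none, some 1]
def pat31S : SPat := [some 3, some 1, none]
def patS21 : SPat := [none, some 2, some 1]
def pat2S1 : SPat := [some 2, none, some 1]
def pat21S : SPat := [some 2, some 1, none]
def pat12S : SPat := [some 1, some 2, none]
def pat1S3 : SPat := [some 1, none, some 3]
def patS23 : SPat := [none, some 2, some 3]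
def patS12 : SPat := [none, some 1, some 2]
def pat23S : SPat := [some 2, some 3, none]
def pat13S : SPat := [some 1, some 3, none]
def pat1S2 : SPat := [some 1, none, some 2]

/-- The entry at (0-indexed) position `i` of `π` is a left-to-right minimum. -/
def IsLRMin (π : List ℕ) (i : ℕ) : Prop := ∀ j < i, π.getD i 0 < π.getD j 0

instance (π : List ℕ) (i : ℕ) : Decidable (IsLRMin π i) := by
  unfold IsLRMin; infer_instance

/-- The number of left-to-right minima of `π`. -/
def numLRMin (π : List ℕ) : ℕ :=
  ((List.range π.length).filter fun i => decide (IsLRMin π i)).length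

/-- `π` has at least one element that is not a left-to-right minimum. -/
def HasNonMin (π : List ℕ) : Prop := ∃ i < π.length, ¬ IsLRMin π i

/-- The 0-indexed position of the leftmost non-left-to-right-minimum, if any. -/
def leftNonMin (π : List ℕ) : Option ℕ :=
  (List.range π.length).find? fun i => ! decide (IsLRMin π i)

/-- The 0-indexed position of the rightmost non-left-to-right-minimum, if any. -/
def rightNonMin (π : List ℕ) : Option ℕ :=
  (List.range π.length).reverse.find? fun i => ! decide (IsLRMin π i)

/-- The values of the non-left-to-right-minimum entries of `π`. -/
def nonMinVals (π : List ℕ) : List ℕ :=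
  ((List.range π.length).filter fun i => ! decide (IsLRMin π i)).map fun i => π.getD i 0

/-- The largest non-left-to-right-minimum value of `π`. -/
def maxNonMin (π : List ℕ) : ℕ := (nonMinVals π).foldr max 0

/-- The smallest non-left-to-right-minimum value of `π`. -/
def minNonMin (π : List ℕ) : ℕ := (nonMinVals π).foldr min π.length

/-- The number of left-to-right minima of `π` whose value is less than the
value of the largest non-left-to-right-minimum element. -/
def vStatMax (π : List ℕ) : ℕ :=
  ((List.range π.length).filter fun i =>
    decide (IsLRMin π i) && decide (π.getD i 0 < maxNonMin π)).length

/-- The number of left-to-right minima of `π` whose value is less than the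
value of the smallest non-left-to-right-minimum element. -/
def vStatMin (π : List ℕ) : ℕ :=
  ((List.range π.length).filter fun i =>
    decide (IsLRMin π i) && decide (π.getD i 0 < minNonMin π)).length

section Helpers

/-- `f` occurs before `e` in the list. -/
def Bef : List ℕ → ℕ → ℕ → Prop
  | [], _, _ => False
  | a :: l, f, e => (f = a ∧ e ∈ l) ∨ Bef l f e

theorem bef_mem {l : List ℕ} {f e : ℕ} (h : Bef l f e) : f ∈ l ∧ e ∈ l := by
  induction l with
  | nil => exact h.elim
  | cons a l ih =>
    rcases h with ⟨rfl, h⟩ | h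
    · simp [h]
    · simp [ih h]

theorem bef_append (A B : List ℕ) (f e : ℕ) :
    Bef (A ++ B) f e ↔ Bef A f e ∨ Bef B f e ∨ (f ∈ A ∧ e ∈ B) := by
  induction A with
  | nil => simp [Bef]
  | cons a l ih =>
    simp only [List.cons_append, Bef, ih, List.mem_append, List.mem_cons]
    tauto

theorem bef_cons (a : ℕ) (l : List ℕ) (f e : ℕ) :
    Bef (a :: l) f e ↔ (f = a ∧ e ∈ l) ∨ Bef l f e := Iff.rfl

theorem bef_nil (f e : ℕ) : ¬ Bef [] f e := fun h => h

theorem bef_split {l : List ℕ} {f e : ℕ} (h : Bef l f e) :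
    ∃ P Q D, l = P ++ f :: Q ++ e :: D := by
  induction l with
  | nil => exact h.elim
  | cons a l ih =>
    rcases h with ⟨rfl, h⟩ | h
    · obtain ⟨Q, D, rfl⟩ := List.append_of_mem h
      exact ⟨[], Q, D, by simp⟩
    · obtain ⟨P, Q, D, rfl⟩ := ih h
      exact ⟨a :: P, Q, D, by simp⟩

theorem bef_total {l : List ℕ} {f e : ℕ} (hf : f ∈ l) (he : e ∈ l) (hne : f ≠ e) :
    Bef l f e ∨ Bef l e f := by
  induction l with
  | nil => simp at hf
  | cons a l ih =>
    simp only [Bef, List.mem_cons] at *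
    grind

theorem bef_idx {l : List ℕ} (hl : l.Nodup) (i j : ℕ) (hi : i < l.length) (hj : j < l.length) :
    Bef l l[i] l[j] ↔ i < j := by
  induction l generalizing i j with
  | nil => simp at hi
  | cons a l ih =>
    have hn := List.nodup_cons.1 hl
    cases i with
    | zero =>
      cases j with
      | zero =>
        simp only [Bef, List.getElem_cons_zero, lt_irrefl, iff_false]
        rintro (⟨_, h⟩ | h)
        · exact hn.1 h
        · exact hn.1 (bef_mem h).1
      | succ j =>
        simp [Bef]
    | succ i =>
      cases j with
      | zero =>
        simp only [Bef, List.getElem_cons_zero, List.getElem_cons_succ]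
        constructor
        · rintro (⟨_, h⟩ | h)
          · exact (hn.1 h).elim
          · exact (hn.1 (bef_mem h).2).elim
        · intro h; omega
      | succ j =>
        simp only [Bef, List.getElem_cons_succ]
        rw [ih hn.2]
        constructor
        · rintro (⟨h, _⟩ | h)
          · exact (hn.1 (h ▸ List.getElem_mem _)).elim
          · omega
        · intro h; right; omega

/-- `e` is a non-left-to-right-minimum of `l`. -/
def NM (l : List ℕ) (e : ℕ) : Prop := ∃ a, a < e ∧ Bef l a e

theorem nm_mem {l : List ℕ} {e : ℕ} (h : NM l e) : e ∈ l := by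
  obtain ⟨a, _, h⟩ := h
  exact (bef_mem h).2

theorem isLRMin_iff {l : List ℕ} (hl : l.Nodup) (i : ℕ) (hi : i < l.length) :
    IsLRMin l i ↔ ¬ NM l l[i] := by
  constructor
  · rintro h ⟨a, ha, hb⟩
    obtain ⟨j, hj, rfl⟩ := List.getElem_of_mem (bef_mem hb).1
    have := (bef_idx hl j i hj hi).1 hb
    have := h j this
    simp [hi, hj] at this
    omega
  · intro h j hj
    by_contra hc
    have hj' : j < l.length := by omega
    simp [hi, hj'] at hc
    apply h
    refine ⟨l[j], ?_, (bef_idx hl j i hj' hi).2 hj⟩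
    rcases hc.lt_or_eq with h | h
    · exact h
    · have := (List.Nodup.getElem_inj_iff hl).1 h
      omega

/-- number of indices satisfying a predicate -/
noncomputable def idxCount (l : List ℕ) (P : ℕ → Prop) : ℕ :=
  letI := Classical.decPred P; ((Finset.range l.length).filter P).card

/-- number of elements satisfying a predicate -/
noncomputable def elCount (l : List ℕ) (P : ℕ → Prop) : ℕ :=
  letI := Classical.decPred P; (l.toFinset.filter P).card

theorem idxCount_eq {l : List ℕ} (hl : l.Nodup) (P Q : ℕ → Prop)
    (h : ∀ i (hi : i < l.length), P i ↔ Q l[i]) : idxCount l P = elCount l Q := by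
  classical
  unfold idxCount elCount
  refine Finset.card_bij (fun i _ => l.getD i 0) ?_ ?_ ?_
  · intro i hi
    simp only [Finset.mem_filter, Finset.mem_range, List.mem_toFinset] at hi ⊢
    simp only [hi.1, List.getD_eq_getElem, List.getElem_mem, true_and]
    exact (h i hi.1).1 hi.2
  · intro i hi j hj hij
    simp only [Finset.mem_filter, Finset.mem_range] at hi hj
    simp only [hi.1, hj.1, List.getD_eq_getElem] at hij
    exact (List.Nodup.getElem_inj_iff hl).1 hij
  · intro e he
    simp only [Finset.mem_filter, List.mem_toFinset] at he
    obtain ⟨i, hi, rfl⟩ := List.getElem_of_mem he.1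
    refine ⟨i, ?_, by simp [hi]⟩
    simp only [Finset.mem_filter, Finset.mem_range]
    exact ⟨hi, (h i hi).2 he.2⟩

theorem idxCount_congr {l m : List ℕ} (hlen : l.length = m.length) (P Q : ℕ → Prop)
    (h : ∀ i, i < l.length → (P i ↔ Q i)) : idxCount l P = idxCount m Q := by
  classical
  unfold idxCount
  rw [← hlen]
  congr 1
  apply Finset.filter_congr
  intro i hi
  exact h i (Finset.mem_range.1 hi)

theorem elCount_congr {l m : List ℕ} (P Q : ℕ → Prop)
    (h : ∀ e, (e ∈ l ∧ P e) ↔ (e ∈ m ∧ Q e)) : elCount l P = elCount m Q := by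
  classical
  unfold elCount
  congr 1
  ext e
  simp [h e]

noncomputable def s1 (l : List ℕ) : ℕ := idxCount l (fun i => IsLRMin l i)
noncomputable def s2 (l : List ℕ) : ℕ :=
  idxCount l (fun i => IsLRMin l i ∧ ∀ j, j < l.length → ¬ IsLRMin l j → j < i)
noncomputable def s3 (l : List ℕ) : ℕ :=
  idxCount l (fun i => IsLRMin l i ∧
    ∀ j, j < l.length → ¬ IsLRMin l j → l.getD i 0 < l.getD j 0)

noncomputable def t1 (l : List ℕ) : ℕ := elCount l (fun e => ¬ NM l e)
noncomputable def t2 (l : List ℕ) : ℕ := elCount l (fun e => ¬ NM l e ∧ ∀ f, NM l f → Bef l f e)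
noncomputable def t3 (l : List ℕ) : ℕ := elCount l (fun e => ¬ NM l e ∧ ∀ f, NM l f → e < f)

theorem s1_eq_t1 {l : List ℕ} (hl : l.Nodup) : s1 l = t1 l :=
  idxCount_eq hl _ _ fun i hi => isLRMin_iff hl i hi

theorem s2_eq_t2 {l : List ℕ} (hl : l.Nodup) : s2 l = t2 l := by
  refine idxCount_eq hl _ _ fun i hi => and_congr (isLRMin_iff hl i hi) ?_
  constructor
  · intro h f hf
    obtain ⟨j, hj, rfl⟩ := List.getElem_of_mem (nm_mem hf)
    rw [bef_idx hl]
    exact h j hj (by rw [isLRMin_iff hl j hj]; simpa using hf)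
  · intro h j hj hm
    rw [isLRMin_iff hl j hj, not_not] at hm
    exact (bef_idx hl j i hj hi).1 (h _ hm)

theorem s3_eq_t3 {l : List ℕ} (hl : l.Nodup) : s3 l = t3 l := by
  refine idxCount_eq hl _ _ fun i hi => and_congr (isLRMin_iff hl i hi) ?_
  constructor
  · intro h f hf
    obtain ⟨j, hj, rfl⟩ := List.getElem_of_mem (nm_mem hf)
    have := h j hj (by rw [isLRMin_iff hl j hj]; simpa using hf)
    simpa [hi, hj] using this
  · intro h j hj hm
    rw [isLRMin_iff hl j hj, not_not] at hm
    simpa [hi, hj] using h _ hm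

theorem ordIso_lrmin {u v : List ℕ} (h : OrdIso u v) (i : ℕ) (hi : i < u.length) :
    IsLRMin u i ↔ IsLRMin v i := by
  unfold IsLRMin
  refine forall_congr' fun j => forall_congr' fun hj => h.2 i j hi (by omega)

/-- equality of statistics -/
def SameStat (u v : List ℕ) : Prop := s1 u = s1 v ∧ s2 u = s2 v ∧ s3 u = s3 v

theorem SameStat.symm {u v : List ℕ} (h : SameStat u v) : SameStat v u :=
  ⟨h.1.symm, h.2.1.symm, h.2.2.symm⟩

theorem SameStat.trans {u v w : List ℕ} (h : SameStat u v) (h' : SameStat v w) : SameStat u w :=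
  ⟨h.1.trans h'.1, h.2.1.trans h'.2.1, h.2.2.trans h'.2.2⟩

theorem sameStat_of_ordIso {u v : List ℕ} (h : OrdIso u v) : SameStat u v := by
  refine ⟨idxCount_congr h.1 _ _ fun i hi => ordIso_lrmin h i hi,
    idxCount_congr h.1 _ _ fun i hi => and_congr (ordIso_lrmin h i hi) ?_,
    idxCount_congr h.1 _ _ fun i hi => and_congr (ordIso_lrmin h i hi) ?_⟩
  · rw [← h.1]
    refine forall_congr' fun j => forall_congr' fun hj => ?_
    rw [ordIso_lrmin h j hj]
  · rw [← h.1]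
    refine forall_congr' fun j => forall_congr' fun hj => ?_
    rw [ordIso_lrmin h j hj, h.2 i j hi hj]

/-- A `123 → 1★2` step on lists of distinct integers. -/
def Step (u v : List ℕ) : Prop :=
  ∃ P Q D : List ℕ, ∃ x y z : ℕ, x ∈ P ∧ x < y ∧ y < z ∧
    u = P ++ y :: Q ++ z :: D ∧ v = P ++ Q ++ y :: D ∧ u.Nodup

theorem Step.nodup_right {u v : List ℕ} (h : Step u v) : v.Nodup := by
  obtain ⟨P, Q, D, x, y, z, hx, hxy, hyz, rfl, rfl, hn⟩ := h
  simp only [List.nodup_append, List.nodup_cons, List.mem_append, List.mem_cons] at hn ⊢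
  grind

theorem step_bef {P Q D : List ℕ} {y z : ℕ} 
    (hn : (P ++ y :: Q ++ z :: D).Nodup) (a e : ℕ) (hay : a ≠ y) (haz : a ≠ z) (hey : e ≠ y)
    (hez : e ≠ z) : Bef (P ++ y :: Q ++ z :: D) a e ↔ Bef (P ++ Q ++ y :: D) a e := by
  simp only [bef_append, bef_cons, List.mem_append, List.mem_cons]
  tauto

theorem step_nm {P Q D : List ℕ} {x y z : ℕ} (hx : x ∈ P) (hxy : x < y) (hyz : y < z)
    (hn : (P ++ y :: Q ++ z :: D).Nodup) (e : ℕ) :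
    NM (P ++ y :: Q ++ z :: D) e ↔ NM (P ++ Q ++ y :: D) e ∨ e = z := by
  have hyu : NM (P ++ y :: Q ++ z :: D) y := by
    refine ⟨x, hxy, ?_⟩
    simp only [bef_append, bef_cons, List.mem_append, List.mem_cons]
    tauto
  have hzu : NM (P ++ y :: Q ++ z :: D) z := by
    refine ⟨x, hxy.trans hyz, ?_⟩
    simp only [bef_append, bef_cons, List.mem_append, List.mem_cons]
    tauto
  have hyv : NM (P ++ Q ++ y :: D) y := by
    refine ⟨x, hxy, ?_⟩
    simp only [bef_append, bef_cons, List.mem_append, List.mem_cons]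
    tauto
  by_cases hez : e = z
  · subst hez; tauto
  by_cases hey : e = y
  · subst hey; tauto
  have hxne : x ≠ y ∧ x ≠ z := ⟨by omega, by omega⟩
  simp only [hez, or_false]
  have hmem : ∀ a, Bef (P ++ y :: Q ++ z :: D) a e → (a = y ∨ a = z) →
      Bef (P ++ Q ++ y :: D) x e := by
    intro a h1 h2
    have hb1 : ∀ w, Bef P w e → w ∈ P := fun w h => (bef_mem h).1
    have hb2 : ∀ w, Bef Q w e → w ∈ Q ∧ e ∈ Q := fun w h => (bef_mem h)
    have hb3 : ∀ w, Bef D w e → w ∈ D ∧ e ∈ D := fun w h => (bef_mem h)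
    simp only [List.nodup_append, List.nodup_cons, List.mem_append, List.mem_cons] at hn
    simp only [bef_append, bef_cons, List.mem_append, List.mem_cons] at h1 ⊢
    grind
  constructor
  · rintro ⟨a, hae, hb⟩
    by_cases ha : a = y ∨ a = z
    · exact ⟨x, by omega, hmem a hb ha⟩
    · push Not at ha
      exact ⟨a, hae, (step_bef hn a e ha.1 ha.2 hey hez).1 hb⟩
  · rintro ⟨a, hae, hb⟩
    by_cases ha : a = y
    · refine ⟨x, by omega, ?_⟩
      have hb1 : ∀ w, Bef P w e → w ∈ P := fun w h => (bef_mem h).1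
      have hb2 : ∀ w, Bef Q w e → w ∈ Q ∧ e ∈ Q := fun w h => (bef_mem h)
      have hb3 : ∀ w, Bef D w e → w ∈ D ∧ e ∈ D := fun w h => (bef_mem h)
      simp only [List.nodup_append, List.nodup_cons, List.mem_append, List.mem_cons] at hn
      simp only [bef_append, bef_cons, List.mem_append, List.mem_cons] at hb ⊢
      grind
    · have haz : a ≠ z := by
        rintro rfl
        have := (bef_mem hb).1
        simp only [List.nodup_append, List.nodup_cons, List.mem_append, List.mem_cons] at hn this
        grind
      exact ⟨a, hae, (step_bef hn a e ha haz hey hez).2 hb⟩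

theorem sameStat_of_step {u v : List ℕ} (h : Step u v) : SameStat u v := by
  have hv := h.nodup_right
  obtain ⟨P, Q, D, x, y, z, hx, hxy, hyz, rfl, rfl, hn⟩ := h
  have key := step_nm hx hxy hyz hn
  have hyv : NM (P ++ Q ++ y :: D) y := by
    refine ⟨x, hxy, ?_⟩
    simp only [bef_append, bef_cons, List.mem_append, List.mem_cons]
    tauto
  have hzv : z ∉ (P ++ Q ++ y :: D) := by
    simp only [List.nodup_append, List.nodup_cons, List.mem_append, List.mem_cons] at hn ⊢
    grind
  have hmm : ∀ e, (e ∈ (P ++ y :: Q ++ z :: D)) ↔ (e ∈ (P ++ Q ++ y :: D) ∨ e = z) := by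
    intro e
    simp only [List.mem_append, List.mem_cons]
    tauto
  have hyu := (key y).2 (Or.inl hyv)
  unfold SameStat
  rw [s1_eq_t1 hn, s2_eq_t2 hn, s3_eq_t3 hn, s1_eq_t1 hv, s2_eq_t2 hv, s3_eq_t3 hv]
  refine ⟨elCount_congr _ _ fun e => ?_, elCount_congr _ _ fun e => ?_,
    elCount_congr _ _ fun e => ?_⟩
  · rw [key, hmm]
    by_cases he : e = z
    · subst he; tauto
    · simp [he]
  · rw [key, hmm]
    by_cases he : e = z
    · subst he; tauto
    by_cases hey : e = y
    · subst hey; tauto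
    simp only [he, or_false, key]
    refine and_congr_right fun hev => and_congr_right fun hne => ?_
    have hb1 : ∀ w, Bef P w e → w ∈ P ∧ e ∈ P := fun w h => (bef_mem h)
    have hb2 : ∀ w, Bef Q w e → w ∈ Q ∧ e ∈ Q := fun w h => (bef_mem h)
    have hb3 : ∀ w, Bef D w e → w ∈ D ∧ e ∈ D := fun w h => (bef_mem h)
    have hn' := hn
    simp only [List.nodup_append, List.nodup_cons, List.mem_append, List.mem_cons] at hn'
    have e1 : Bef (P ++ y :: Q ++ z :: D) z e ↔ e ∈ D := by
      simp only [bef_append, bef_cons, List.mem_append, List.mem_cons]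
      grind
    have e2 : Bef (P ++ Q ++ y :: D) y e ↔ e ∈ D := by
      simp only [bef_append, bef_cons, List.mem_append, List.mem_cons]
      grind
    have e3 : e ∈ D → Bef (P ++ y :: Q ++ z :: D) y e := by
      intro h
      simp only [bef_append, bef_cons, List.mem_append, List.mem_cons]
      grind
    constructor
    · intro h f hf
      by_cases hfy : f = y
      · subst hfy
        exact e2.2 (e1.1 (h z (Or.inr rfl)))
      · have hfz : f ≠ z := fun h => hzv (h ▸ nm_mem hf)
        exact (step_bef hn f e hfy hfz hey he).1 (h f (Or.inl hf))
    · intro h f hf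
      have hD := e2.1 (h y hyv)
      by_cases hfy : f = y
      · subst hfy; exact e3 hD
      by_cases hfz : f = z
      · subst hfz; exact e1.2 hD
      exact (step_bef hn f e hfy hfz hey he).2 (h f (hf.resolve_right hfz))
  · rw [key, hmm]
    by_cases he : e = z
    · subst he; tauto
    simp only [he, or_false, key]
    refine and_congr_right fun hev => and_congr_right fun hne => ?_
    constructor
    · intro h f hf
      exact h f (Or.inl hf)
    · rintro h f (hf | rfl)
      · exact h f hf
      · exact (h y hyv).trans hyz

end Helpers

section Helpers2

theorem OrdIso.symm' {u v : List ℕ} (h : OrdIso u v) : OrdIso v u :=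
  ⟨h.1.symm, fun i j hi hj => (h.2 i j (h.1 ▸ hi) (h.1 ▸ hj)).symm⟩

theorem OrdIso.trans' {u v w : List ℕ} (h : OrdIso u v) (h' : OrdIso v w) : OrdIso u w :=
  ⟨h.1.trans h'.1, fun i j hi hj =>
    (h.2 i j hi hj).trans (h'.2 i j (h.1 ▸ hi) (h.1 ▸ hj))⟩

theorem ordIso_map (u : List ℕ) (f : ℕ → ℕ) (hf : ∀ a ∈ u, ∀ b ∈ u, (a < b ↔ f a < f b)) :
    OrdIso u (u.map f) := by
  refine ⟨by simp, fun i j hi hj => ?_⟩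
  simp only [hi, hj, List.getD_eq_getElem, List.length_map, List.getElem_map]
  exact hf _ (List.getElem_mem _) _ (List.getElem_mem _)

theorem OrdIso.nodup {u v : List ℕ} (h : OrdIso u v) (hu : u.Nodup) : v.Nodup := by
  rw [List.nodup_iff_injective_get] at hu ⊢
  intro i j hij
  have hi : i.1 < u.length := by have := i.2; have := h.1; omega
  have hj : j.1 < u.length := by have := j.2; have := h.1; omega
  have h1 := h.2 i j hi hj
  have h2 := h.2 j i hj hi
  simp only [List.get_eq_getElem] at hij
  simp only [hi, hj, List.getD_eq_getElem, i.2, j.2, hij, lt_irrefl, iff_false] at h1 h2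
  have : u[i.1] = u[j.1] := by omega
  have := @hu ⟨i, hi⟩ ⟨j, hj⟩ (by simpa using this)
  ext
  simpa using this

theorem copy123 {a : SPat} (h : IsCopy a pat123) :
    ∃ x y z, a = [some x, some y, some z] ∧ x < y ∧ y < z := by
  obtain ⟨h1, h2, h3⟩ := h
  match a, h1 with
  | [p, q, r], _ =>
    have e0 := h2 0
    have e1 := h2 1
    have e2 := h2 2
    match p, q, r with
    | some x, some y, some z =>
      refine ⟨x, y, z, rfl, ?_, ?_⟩
      · have := h3.2 0 1 (by simp [ints]) (by simp [ints])
        simpa [ints, pat123] using this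
      · have := h3.2 1 2 (by simp [ints]) (by simp [ints])
        simpa [ints, pat123] using this
    | none, _, _ => simp [pat123] at e0
    | some _, none, _ => simp [pat123] at e1
    | some _, some _, none => simp [pat123] at e2

theorem copy1S2 {a : SPat} (h : IsCopy a pat1S2) :
    ∃ x y, a = [some x, none, some y] ∧ x < y := by
  obtain ⟨h1, h2, h3⟩ := h
  match a, h1 with
  | [p, q, r], _ =>
    have e0 := h2 0
    have e1 := h2 1
    have e2 := h2 2
    match p, q, r with
    | some x, none, some z =>
      refine ⟨x, z, rfl, ?_⟩
      have := h3.2 0 1 (by simp [ints]) (by simp [ints])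
      simpa [ints, pat1S2] using this
    | none, _, _ => simp [pat1S2] at e0
    | some _, some _, _ => simp [pat1S2] at e1
    | some _, none, none => simp [pat1S2] at e2

theorem copy123_mk {x y z : ℕ} (h1 : x < y) (h2 : y < z) :
    IsCopy [some x, some y, some z] pat123 := by
  refine ⟨rfl, ?_, rfl, ?_⟩
  · intro i
    match i with
    | 0 => simp [pat123]
    | 1 => simp [pat123]
    | 2 => simp [pat123]
    | n + 3 => simp [pat123]
  · intro i j hi hj
    simp only [ints, List.filterMap_cons, id, List.filterMap_nil, List.length_cons,
      List.length_nil] at hi hj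
    interval_cases i <;> interval_cases j <;> simp [ints, pat123] <;> omega

theorem copy1S2_mk {x y : ℕ} (h1 : x < y) :
    IsCopy [some x, none, some y] pat1S2 := by
  refine ⟨rfl, ?_, rfl, ?_⟩
  · intro i
    match i with
    | 0 => simp [pat1S2]
    | 1 => simp [pat1S2]
    | 2 => simp [pat1S2]
    | n + 3 => simp [pat1S2]
  · intro i j hi hj
    simp only [ints, List.filterMap_cons, id, List.filterMap_nil, List.length_cons,
      List.length_nil] at hi hj
    interval_cases i <;> interval_cases j <;> simp [ints, pat1S2] <;> omega

theorem repl_nil_inv {r s : SPat} {a b : SPat} (h : Repl a b r s) (ha : a = []) : r = s := by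
  induction h with
  | nil => rfl
  | keep x _ ih => rw [ih ha]
  | repl => simp at ha

theorem repl_cons_inv {a b r s : SPat} (h : Repl a b r s) :
    ∀ x a' y b', a = x :: a' → b = y :: b' →
      ∃ A r' s', r = A ++ x :: r' ∧ s = A ++ y :: s' ∧ Repl a' b' r' s' := by
  induction h with
  | nil => intro x a' y b' h; simp at h
  | keep w _ ih =>
    intro x a' y b' h1 h2
    obtain ⟨A, r', s', rfl, rfl, h⟩ := ih x a' y b' h1 h2
    exact ⟨w :: A, r', s', rfl, rfl, h⟩
  | repl p q h _ =>
    intro x a' y b' h1 h2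
    simp only [List.cons.injEq] at h1 h2
    obtain ⟨rfl, rfl⟩ := h1
    obtain ⟨rfl, rfl⟩ := h2
    exact ⟨[], _, _, rfl, rfl, h⟩

theorem repl3_inv {x y z x' y' z' : Option ℕ} {r s : SPat}
    (h : Repl [x, y, z] [x', y', z'] r s) :
    ∃ A B C D, r = A ++ x :: B ++ y :: C ++ z :: D ∧ s = A ++ x' :: B ++ y' :: C ++ z' :: D := by
  obtain ⟨A, r1, s1, rfl, rfl, h1⟩ := repl_cons_inv h _ _ _ _ rfl rfl
  obtain ⟨B, r2, s2, rfl, rfl, h2⟩ := repl_cons_inv h1 _ _ _ _ rfl rfl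
  obtain ⟨C, r3, s3, rfl, rfl, h3⟩ := repl_cons_inv h2 _ _ _ _ rfl rfl
  obtain rfl := repl_nil_inv h3 rfl
  exact ⟨A, B, C, r3, by simp, by simp⟩

theorem repl_keep_append {a b r s : SPat} (A : SPat) (h : Repl a b r s) :
    Repl a b (A ++ r) (A ++ s) := by
  induction A with
  | nil => exact h
  | cons x A ih => exact Repl.keep x ih

theorem repl3_mk (x y z x' y' z' : Option ℕ) (A B C D : SPat) :
    Repl [x, y, z] [x', y', z'] (A ++ x :: B ++ y :: C ++ z :: D)
      (A ++ x' :: B ++ y' :: C ++ z' :: D) := by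
  simp only [List.append_assoc, List.cons_append]
  refine repl_keep_append _ (Repl.repl _ _ (repl_keep_append _ (Repl.repl _ _
    (repl_keep_append _ (Repl.repl _ _ ?_)))))
  have := repl_keep_append D Repl.nil
  simpa using this

theorem ints_append (A B : SPat) : ints (A ++ B) = ints A ++ ints B := by simp [ints]
theorem ints_some (x : ℕ) (B : SPat) : ints (some x :: B) = x :: ints B := by simp [ints]
theorem ints_none (B : SPat) : ints (none :: B) = ints B := by simp [ints]
theorem ints_nil : ints [] = [] := by simp [ints]
theorem ints_map (f : ℕ → ℕ) (A : List ℕ) : ints (A.map (fun x => some (f x))) = A.map f := by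
  induction A with
  | nil => simp [ints]
  | cons a A ih => rw [List.map_cons, ints_some, ih, List.map_cons]

theorem result_fwd {p q : List ℕ} (h : IsResult pat123 pat1S2 p q) :
    ∃ u v, Step u v ∧ OrdIso p u ∧ OrdIso v q := by
  obtain ⟨r, s, a, b, hs, ho, ha, hb, hb', hd, hc, hr, hq, ho'⟩ := h
  obtain ⟨x, y, z, rfl, hxy, hyz⟩ := copy123 ha
  obtain ⟨x', y', rfl, hxy'⟩ := copy1S2 hb'
  have h1 := hc 0 0 1 (by simp [pat123]) (by simp [pat1S2])
  have h2 := hc 1 2 2 (by simp [pat123]) (by simp [pat1S2])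
  simp at h1 h2
  subst h1 h2
  obtain ⟨A, B, C, D, rfl, rfl⟩ := repl3_inv hr
  refine ⟨_, _, ⟨ints A ++ x :: ints B, ints C, ints D, x, y, z, by simp, hxy, hyz, rfl, rfl, ?_⟩,
    ?_, ?_⟩
  · have := hs.1
    simpa [ints_append, ints_some, ints_none] using this
  · simpa [ints_append, ints_some, ints_none] using ho
  · simpa [ints_append, ints_some, ints_none] using ho'

theorem result_bwd {p q : List ℕ} (h : IsResult pat1S2 pat123 p q) :
    ∃ u v, Step u v ∧ OrdIso p v ∧ OrdIso u q := by
  obtain ⟨r, s, a, b, hs, ho, ha, hb, hb', hd, hc, hr, hq, ho'⟩ := h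
  obtain ⟨x, y, rfl, hxy⟩ := copy1S2 ha
  obtain ⟨x', y', z, rfl, hxy', hyz⟩ := copy123 hb'
  have h1 := hc 0 0 1 (by simp [pat1S2]) (by simp [pat123])
  have h2 := hc 2 1 2 (by simp [pat1S2]) (by simp [pat123])
  simp at h1 h2
  subst h1 h2
  obtain ⟨A, B, C, D, rfl, rfl⟩ := repl3_inv hr
  have hz : z ∉ ints (A ++ some x :: B ++ none :: C ++ some y :: D) := by
    intro hz
    have := hd z (by simp [ints]) hz
    simp [ints] at this
    omega
  refine ⟨_, _, ⟨ints A ++ x :: ints B, ints C, ints D, x, y, z, by simp, hxy, hyz, rfl, rfl, ?_⟩,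
    ?_, ?_⟩
  · have := hs.1
    simp only [ints_append, ints_some, ints_none] at this hz
    simp only [List.nodup_append, List.nodup_cons, List.mem_append, List.mem_cons] at this hz ⊢
    grind
  · simpa [ints_append, ints_some, ints_none] using ho
  · simpa [ints_append, ints_some, ints_none] using ho'

def stdize (u : List ℕ) : List ℕ :=
  u.map (fun e => (u.toFinset.filter (fun x => x ≤ e)).card)

theorem stdize_ordIso (u : List ℕ) : OrdIso u (stdize u) := by
  apply ordIso_map
  intro a ha b hb
  constructor
  · intro h
    apply Finset.card_lt_card
    rw [Finset.ssubset_iff_of_subset]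
    · refine ⟨b, ?_, ?_⟩ <;> simp [hb, h]
    · intro x
      simp only [Finset.mem_filter]
      exact fun hx => ⟨hx.1, by omega⟩
  · intro h
    by_contra hc
    have : (u.toFinset.filter (fun x => x ≤ b)).card ≤ (u.toFinset.filter (fun x => x ≤ a)).card := by
      apply Finset.card_le_card
      intro x
      simp only [Finset.mem_filter]
      exact fun hx => ⟨hx.1, by omega⟩
    omega

theorem permList_of_nodup {u : List ℕ} (hu : u.Nodup) (h : ∀ e ∈ u, 1 ≤ e ∧ e ≤ u.length) :
    IsPermList u := by
  have hsub : u ⊆ List.range' 1 u.length := by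
    intro e he
    have := h e he
    simp only [List.mem_range'_1]
    omega
  exact (List.subperm_of_subset hu hsub).perm_of_length_le (by simp)

theorem stdize_perm {u : List ℕ} (hu : u.Nodup) : IsPermList (stdize u) := by
  apply permList_of_nodup ((stdize_ordIso u).nodup hu)
  intro e he
  simp only [stdize, List.mem_map] at he
  obtain ⟨a, ha, rfl⟩ := he
  constructor
  · apply Finset.card_pos.2
    exact ⟨a, by simp [ha]⟩
  · calc _ ≤ u.toFinset.card := Finset.card_le_card (Finset.filter_subset _ _)
      _ = (stdize u).length := by simp [stdize, List.toFinset_card_of_nodup hu]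

theorem IsPermList.nodup {p : List ℕ} (h : IsPermList p) : p.Nodup :=
  h.nodup_iff.2 List.nodup_range'

theorem IsPermList.mem_iff {p : List ℕ} (h : IsPermList p) (e : ℕ) :
    e ∈ p ↔ 1 ≤ e ∧ e ≤ p.length := by
  rw [List.Perm.mem_iff h, List.mem_range'_1]
  omega

theorem stdize_self {p : List ℕ} (h : IsPermList p) : stdize p = p := by
  conv_rhs => rw [← List.map_id p]
  apply List.map_congr_left
  intro e he
  have he' := (h.mem_iff e).1 he
  have : p.toFinset.filter (fun x => x ≤ e) = Finset.Icc 1 e := by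
    ext x
    simp only [Finset.mem_filter, List.mem_toFinset, h.mem_iff, Finset.mem_Icc]
    omega
  rw [this]
  simp

theorem step_result {u v : List ℕ} (h : Step u v) :
    IsResult pat123 pat1S2 (stdize u) (stdize v) ∧
    IsResult pat1S2 pat123 (stdize v) (stdize u) := by
  have hv := h.nodup_right
  have hpu := stdize_ordIso u
  have hpv := stdize_ordIso v
  have hmu := ordIso_map u Nat.succ (by intros; omega)
  have hmv := ordIso_map v Nat.succ (by intros; omega)
  obtain ⟨P, Q, D, x, y, z, hx, hxy, hyz, hu', hv', hn⟩ := h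
  have hpermu := stdize_perm hn
  have hpermv := stdize_perm hv
  obtain ⟨A, B, rfl⟩ := List.append_of_mem hx
  have hnu : (u.map Nat.succ).Nodup := hn.map Nat.succ_injective
  have hnv : (v.map Nat.succ).Nodup := hv.map Nat.succ_injective
  let g : List ℕ → SPat := fun l => l.map (fun x => some (Nat.succ x))
  have hg : ∀ l, ints (g l) = l.map Nat.succ := fun l => ints_map Nat.succ l
  have hiu : ints (g A ++ some (x+1) :: g B ++ some (y+1) :: g Q ++ some (z+1) :: g D)
      = u.map Nat.succ := by
    rw [hu']
    simp [ints_append, ints_some, hg]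
  have hiv : ints (g A ++ some (x+1) :: g B ++ none :: g Q ++ some (y+1) :: g D)
      = v.map Nat.succ := by
    rw [hv']
    simp [ints_append, ints_some, ints_none, hg]
  have hxu : x ≠ y ∧ x ≠ z ∧ y ≠ z := by omega
  constructor
  · refine ⟨_, _, _, _, ?_, ?_, copy123_mk (Nat.succ_lt_succ hxy) (Nat.succ_lt_succ hyz), ?_,
      copy1S2_mk (Nat.succ_lt_succ hxy), ?_, ?_, repl3_mk _ _ _ _ _ _ (g A) (g B) (g Q) (g D),
      hpermv, ?_⟩
    · unfold StarStr; rw [hiu]; exact ⟨hnu, by simp⟩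
    · rw [hiu]; exact hpu.symm'.trans' hmu
    · simp [StarStr, ints, hxu]
    · intro k hk _
      simp [ints] at hk ⊢
      tauto
    · intro i j w hi hj
      clear hiu hiv hg g hmu hmv hpu hpv hnu hnv hpermu hpermv hu' hv' hn hv
      rcases i with _ | _ | _ | i <;> rcases j with _ | _ | _ | j <;>
        simp [pat123, pat1S2] at hi hj ⊢ <;> omega
    · rw [hiv]; exact hmv.symm'.trans' hpv
  · refine ⟨_, _, _, _, ?_, ?_, copy1S2_mk (Nat.succ_lt_succ hxy), ?_,
      copy123_mk (Nat.succ_lt_succ hxy) (Nat.succ_lt_succ hyz), ?_, ?_,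
      repl3_mk _ _ _ _ _ _ (g A) (g B) (g Q) (g D),
      hpermu, ?_⟩
    · unfold StarStr; rw [hiv]; exact ⟨hnv, by simp⟩
    · rw [hiv]; exact hpv.symm'.trans' hmv
    · simp [StarStr, ints, hxu]
    · intro k hk hk2
      rw [hiv, hv'] at hk2
      rw [hu'] at hn
      have : k ≠ z + 1 := by
        rintro rfl
        simp only [List.mem_map, Nat.succ_eq_add_one, Nat.add_right_cancel_iff,
          exists_eq_right] at hk2
        simp only [List.nodup_append, List.nodup_cons, List.mem_append, List.mem_cons] at hn hk2
        grind
      simp [ints] at hk ⊢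
      tauto
    · intro i j w hi hj
      clear hiu hiv hg g hmu hmv hpu hpv hnu hnv hpermu hpermv hu' hv' hn hv
      rcases i with _ | _ | _ | i <;> rcases j with _ | _ | _ | j <;>
        simp [pat123, pat1S2] at hi hj ⊢ <;> omega
    · rw [hiu]; exact hmu.symm'.trans' hpu

/-- Equivalence on lists of distinct numbers. -/
def Eqv (u v : List ℕ) : Prop :=
  PermEquiv pat123 pat1S2 (stdize u) (stdize v) ∧ PermEquiv pat123 pat1S2 (stdize v) (stdize u)

theorem Eqv.refl' (u : List ℕ) : Eqv u u := ⟨Relation.ReflTransGen.refl, Relation.ReflTransGen.refl⟩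
theorem Eqv.symm' {u v : List ℕ} (h : Eqv u v) : Eqv v u := ⟨h.2, h.1⟩
theorem Eqv.trans' {u v w : List ℕ} (h : Eqv u v) (h' : Eqv v w) : Eqv u w :=
  ⟨Relation.ReflTransGen.trans h.1 h'.1, Relation.ReflTransGen.trans h'.2 h.2⟩
theorem Eqv.of_step {u v : List ℕ} (h : Step u v) : Eqv u v :=
  ⟨Relation.ReflTransGen.single (Or.inl (step_result h).1),
   Relation.ReflTransGen.single (Or.inr (step_result h).2)⟩

theorem delete_eqv {P Q D : List ℕ} {w e m x : ℕ} (hm : m ∈ P) (hmw : m < w)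
    (hx : x ∈ P ++ Q) (hxe : x < e) (hew : e < w) (hn : (P ++ w :: Q ++ e :: D).Nodup) :
    Eqv (P ++ w :: Q ++ e :: D) (P ++ Q ++ e :: D) := by
  let z := (P ++ w :: Q ++ e :: D).sum + 1
  have hz : ∀ a ∈ P ++ w :: Q ++ e :: D, a < z := fun a ha =>
    Nat.lt_succ_of_le (List.le_sum_of_mem ha)
  have hzn : z ∉ P ++ w :: Q ++ e :: D := fun h => lt_irrefl _ (hz z h)
  have hez : e < z := hz e (by simp)
  have hwz : w < z := hz w (by simp)
  have hn1 : ((P ++ w :: Q) ++ e :: [] ++ z :: D).Nodup := by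
    simp only [List.nodup_append, List.nodup_cons, List.mem_append, List.mem_cons] at hn hzn ⊢
    grind
  have st1 : Step ((P ++ w :: Q) ++ e :: [] ++ z :: D) (P ++ w :: Q ++ e :: D) :=
    ⟨P ++ w :: Q, [], D, x, e, z, by
      simp only [List.mem_append, List.mem_cons] at hx ⊢; tauto, hxe, hez, rfl, by simp, hn1⟩
  have st2 : Step ((P ++ w :: Q) ++ e :: [] ++ z :: D) ((P ++ Q) ++ e :: [] ++ w :: D) :=
    ⟨P, Q ++ [e], D, m, w, z, hm, hmw, hwz, by simp, by simp, hn1⟩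
  have st3 : Step ((P ++ Q) ++ e :: [] ++ w :: D) (P ++ Q ++ e :: D) :=
    ⟨P ++ Q, [], D, x, e, w, hx, hxe, hew, rfl, by simp, st2.nodup_right⟩
  exact (Eqv.of_step st1).symm'.trans' ((Eqv.of_step st2).trans' (Eqv.of_step st3))

theorem nm_split {P D : List ℕ} {e : ℕ} (hn : (P ++ e :: D).Nodup) (h : NM (P ++ e :: D) e) :
    ∃ x ∈ P, x < e := by
  obtain ⟨x, hxe, hb⟩ := h
  refine ⟨x, ?_, hxe⟩
  have hb1 : Bef P x e → x ∈ P ∧ e ∈ P := fun h => (bef_mem h)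
  have hb3 : Bef D x e → x ∈ D ∧ e ∈ D := fun h => (bef_mem h)
  simp only [List.nodup_append, List.nodup_cons, List.mem_append, List.mem_cons] at hn
  simp only [bef_append, bef_cons, List.mem_append, List.mem_cons] at hb
  grind

theorem nm_mk {P D : List ℕ} {e x : ℕ} (hx : x ∈ P) (h : x < e) : NM (P ++ e :: D) e := by
  refine ⟨x, h, ?_⟩
  simp only [bef_append, bef_cons, List.mem_append, List.mem_cons]
  tauto

theorem reduce (n : ℕ) : ∀ u : List ℕ, u.length ≤ n → u.Nodup → (∃ e, NM u e) →
    ∃ v, v.Nodup ∧ Eqv u v ∧ ∃ e, NM v e ∧ ∀ f, NM v f → f = e := by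
  induction n with
  | zero =>
    intro u hu _ ⟨e, he⟩
    have := nm_mem he
    simp at hu
    simp [hu] at this
  | succ n ih =>
    intro u hlen hn ⟨e0, he0⟩
    by_cases huniq : ∀ f, NM u f → f = e0
    · exact ⟨u, hn, Eqv.refl' u, e0, he0, huniq⟩
    push Not at huniq
    obtain ⟨f0, hf0, hne⟩ := huniq
    obtain ⟨w, e, hw, he, hwe⟩ : ∃ w e, NM u w ∧ NM u e ∧ Bef u w e := by
      rcases bef_total (nm_mem he0) (nm_mem hf0) hne.symm with h | h
      · exact ⟨_, _, he0, hf0, h⟩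
      · exact ⟨_, _, hf0, he0, h⟩
    obtain ⟨P, Q, D, rfl⟩ := bef_split hwe
    obtain ⟨m, hm, hmw⟩ : ∃ x ∈ P, x < w := by
      apply nm_split (D := Q ++ e :: D)
      · simpa using hn
      · simpa using hw
    obtain ⟨x, hx, hxe⟩ := nm_split hn he
    have hwne : w ≠ e := by
      simp only [List.nodup_append, List.nodup_cons, List.mem_append, List.mem_cons] at hn
      grind
    rcases Nat.lt_or_gt_of_ne hwne with hlt | hlt
    · have st : Step (P ++ w :: Q ++ e :: D) (P ++ Q ++ w :: D) :=
        ⟨P, Q, D, m, w, e, hm, hmw, hlt, rfl, rfl, hn⟩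
      obtain ⟨v, hv, hev, h⟩ := ih (P ++ Q ++ w :: D) (by simp at hlen ⊢; omega) st.nodup_right
        ⟨w, nm_mk (x := m) (by simp [hm]) hmw⟩
      exact ⟨v, hv, (Eqv.of_step st).trans' hev, h⟩
    · have hx' : x ∈ P ++ Q := by
        simp only [List.mem_append, List.mem_cons] at hx ⊢
        rcases hx with h | h | h
        · exact Or.inl h
        · omega
        · exact Or.inr h
      have hd := delete_eqv hm hmw hx' hxe hlt hn
      obtain ⟨v, hv, hev, h⟩ := ih (P ++ Q ++ e :: D) (by simp at hlen ⊢; omega) (by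
        simp only [List.nodup_append, List.nodup_cons, List.mem_append, List.mem_cons] at hn ⊢
        grind) ⟨e, nm_mk hx' hxe⟩
      exact ⟨v, hv, hd.trans' hev, h⟩

/-- Invariance of the statistics. -/
theorem sameStat_of_equiv {p q : List ℕ} (h : PermEquiv pat123 pat1S2 p q) : SameStat p q := by
  induction h with
  | refl => exact ⟨rfl, rfl, rfl⟩
  | tail _ h ih =>
    refine ih.trans ?_
    rcases h with h | h
    · obtain ⟨u, v, hs, h1, h2⟩ := result_fwd h
      exact (sameStat_of_ordIso h1).trans ((sameStat_of_step hs).trans (sameStat_of_ordIso h2))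
    · obtain ⟨u, v, hs, h1, h2⟩ := result_bwd h
      exact (sameStat_of_ordIso h1).trans
        ((sameStat_of_step hs).symm.trans (sameStat_of_ordIso h2))

end Helpers2

section Helpers3

theorem pairwise_of_bef {l : List ℕ} {R : ℕ → ℕ → Prop} (h : ∀ a b, Bef l a b → R a b) :
    l.Pairwise R := by
  induction l with
  | nil => exact List.Pairwise.nil
  | cons c l ih =>
    refine List.Pairwise.cons (fun b hb => h c b (Or.inl ⟨rfl, hb⟩)) (ih fun a b hab =>
      h a b (Or.inr hab))

theorem canon {p : List ℕ} (hp : IsPermList p) {e : ℕ} (he : NM p e)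
    (hu : ∀ f, NM p f → f = e) :
    ∃ A B, p = A ++ e :: B ∧ p.length = s1 p + 1 ∧ B.length = s2 p ∧ e = s3 p + 1 ∧
      (A ++ B).Pairwise (fun a b => b < a) := by
  classical
  have hn := hp.nodup
  have hmem := hp.mem_iff
  have hnm : ∀ f, NM p f ↔ f = e := fun f => ⟨hu f, fun h => h ▸ he⟩
  have hem := nm_mem he
  rw [s1_eq_t1 hn, s2_eq_t2 hn, s3_eq_t3 hn]
  have h1 : p.length = t1 p + 1 := by
    unfold t1 elCount
    have : p.toFinset.filter (fun f => ¬ NM p f) = p.toFinset.erase e := by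
      ext f
      simp only [Finset.mem_filter, List.mem_toFinset, hnm, Finset.mem_erase]
      tauto
    rw [Finset.filter_congr_decidable] 
    rw [this, Finset.card_erase_add_one (by simpa using hem), List.toFinset_card_of_nodup hn]
  have h3 : e = t3 p + 1 := by
    unfold t3 elCount
    have : p.toFinset.filter (fun f => ¬ NM p f ∧ ∀ g, NM p g → f < g) = Finset.Ico 1 e := by
      ext f
      simp only [Finset.mem_filter, List.mem_toFinset, hnm, Finset.mem_Ico, forall_eq, hmem]
      have := (hmem e).1 hem
      omega
    rw [Finset.filter_congr_decidable] 
    rw [this, Nat.card_Ico]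
    have := (hmem e).1 hem
    omega
  obtain ⟨A, B, hAB⟩ := List.append_of_mem hem
  have hn' := hn
  rw [hAB] at hn'
  have h2 : B.length = t2 p := by
    unfold t2 elCount
    have : p.toFinset.filter (fun f => ¬ NM p f ∧ ∀ g, NM p g → Bef p g f) = B.toFinset := by
      ext f
      simp only [Finset.mem_filter, List.mem_toFinset, hnm, forall_eq]
      rw [hAB]
      have hb1 : Bef A e f → e ∈ A ∧ f ∈ A := fun h => (bef_mem h)
      have hb3 : Bef B e f → e ∈ B ∧ f ∈ B := fun h => (bef_mem h)
      simp only [List.nodup_append, List.nodup_cons, List.mem_cons] at hn'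
      simp only [bef_append, bef_cons, List.mem_append, List.mem_cons]
      grind
    rw [Finset.filter_congr_decidable] 
    rw [this, List.toFinset_card_of_nodup]
    simp only [List.nodup_append, List.nodup_cons] at hn'
    exact hn'.2.1.2
  refine ⟨A, B, hAB, h1, h2, h3, pairwise_of_bef fun a b hab => ?_⟩
  by_contra hc
  have hne : a ≠ b := by
    rintro rfl
    have hnAB : (A ++ B).Nodup := by
      simp only [List.nodup_append, List.nodup_cons, List.mem_cons] at hn' ⊢
      grind
    obtain ⟨P, Q, D, hPQ⟩ := bef_split hab
    rw [hPQ] at hnAB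
    simp only [List.nodup_append, List.nodup_cons, List.mem_append, List.mem_cons] at hnAB
    grind
  have hb : b = e := by
    apply hu
    refine ⟨a, by omega, ?_⟩
    rw [hAB]
    simp only [bef_append, bef_cons, List.mem_cons] at hab ⊢
    tauto
  subst hb
  have := (bef_mem hab).2
  simp only [List.nodup_append, List.nodup_cons, List.mem_cons, List.mem_append] at hn' this
  grind

theorem base_eq {p q : List ℕ} (hp : IsPermList p) (hq : IsPermList q) {e f : ℕ} (he : NM p e)
    (heu : ∀ g, NM p g → g = e) (hf : NM q f) (hfu : ∀ g, NM q g → g = f)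
    (h : SameStat p q) : p = q := by
  obtain ⟨A, B, hAB, h1, h2, h3, h4⟩ := canon hp he heu
  obtain ⟨A', B', hAB', h1', h2', h3', h4'⟩ := canon hq hf hfu
  obtain ⟨e1, e2, e3⟩ := h
  have hef : e = f := by omega
  subst hef
  have hlen : p.length = q.length := by omega
  have hpq : p.Perm q := by
    unfold IsPermList at hp hq
    rw [hlen] at hp
    exact hp.trans hq.symm
  have hperm : (A ++ B).Perm (A' ++ B') := by
    rw [hAB, hAB'] at hpq
    have := (List.perm_middle.symm.trans hpq).trans List.perm_middle
    exact this.cons_inv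
  have heq : A ++ B = A' ++ B' :=
    hperm.eq_of_pairwise (fun a b _ _ h1 h2 => by omega) h4 h4'
  obtain ⟨rfl, rfl⟩ := List.append_inj' heq (by omega)
  rw [hAB, hAB']

theorem hasNonMin_iff {p : List ℕ} (hn : p.Nodup) : HasNonMin p ↔ ∃ e, NM p e := by
  constructor
  · rintro ⟨i, hi, h⟩
    rw [isLRMin_iff hn i hi, not_not] at h
    exact ⟨_, h⟩
  · rintro ⟨e, he⟩
    obtain ⟨i, hi, rfl⟩ := List.getElem_of_mem (nm_mem he)
    exact ⟨i, hi, by rw [isLRMin_iff hn i hi, not_not]; exact he⟩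

theorem idxCount_list (l : List ℕ) (P : ℕ → Prop) (b : ℕ → Bool) (h : ∀ i < l.length, P i ↔ b i = true) :
    ((List.range l.length).filter b).length = idxCount l P := by
  classical
  unfold idxCount
  have h1 : (Finset.range l.length).filter P = ((List.range l.length).filter b).toFinset := by
    ext i
    simp only [Finset.mem_filter, Finset.mem_range, List.mem_toFinset, List.mem_filter,
      List.mem_range]
    exact and_congr_right fun hi => h i hi
  rw [Finset.filter_congr_decidable]
  rw [h1, List.toFinset_card_of_nodup (List.nodup_range.filter _)]

theorem numLRMin_eq (p : List ℕ) : numLRMin p = s1 p :=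
  idxCount_list p _ _ fun i _ => by simp

theorem lt_foldr_min (l : List ℕ) (a n : ℕ) :
    a < l.foldr min n ↔ a < n ∧ ∀ x ∈ l, a < x := by
  induction l with
  | nil => simp
  | cons b l ih => simp only [List.foldr_cons, lt_min_iff, ih, List.mem_cons, forall_eq_or_imp]; tauto

theorem vStatMin_eq {p : List ℕ} (hp : IsPermList p) (hm : HasNonMin p) : vStatMin p = s3 p := by
  apply idxCount_list
  intro i hi
  simp only [Bool.and_eq_true, decide_eq_true_eq]
  refine and_congr_right fun _ => ?_
  unfold minNonMin
  rw [lt_foldr_min]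
  have key : (∀ x ∈ nonMinVals p, p.getD i 0 < x) ↔
      ∀ j, j < p.length → ¬ IsLRMin p j → p.getD i 0 < p.getD j 0 := by
    unfold nonMinVals
    simp only [List.mem_map, List.mem_filter, List.mem_range, Bool.not_eq_true',
      decide_eq_false_iff_not, forall_exists_index, and_imp]
    constructor
    · intro h j hj hj'
      exact h _ j hj hj' rfl
    · rintro h x j hj hj' rfl
      exact h j hj hj'
  rw [key]
  constructor
  · intro h
    refine ⟨?_, h⟩
    obtain ⟨j, hj, hj'⟩ := hm
    refine (h j hj hj').trans_le ?_
    rw [List.getD_eq_getElem _ _ hj]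
    exact ((hp.mem_iff _).1 (List.getElem_mem hj)).2
  · exact fun h => h.2

theorem right_eq {p : List ℕ} (hm : HasNonMin p) :
    ∃ i, rightNonMin p = some i ∧ p.length - i = s2 p + 1 := by
  classical
  let S := (Finset.range p.length).filter (fun i => ¬ IsLRMin p i)
  have hS : S.Nonempty := by
    obtain ⟨i, hi, h⟩ := hm
    exact ⟨i, by simp [S, hi, h]⟩
  have hmem : ∀ j, j ∈ S ↔ j < p.length ∧ ¬ IsLRMin p j := by intro j; simp [S]
  obtain ⟨i, hi, hmax⟩ := S.exists_max_image id hS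
  simp only [id] at hmax
  obtain ⟨hi1, hi2⟩ := (hmem i).1 hi
  refine ⟨i, ?_, ?_⟩
  · unfold rightNonMin
    have hsome : ((List.range p.length).reverse.find? fun i => ! decide (IsLRMin p i)).isSome := by
      rw [List.find?_isSome]
      exact ⟨i, by simpa using hi1, by simpa using hi2⟩
    obtain ⟨k, hk⟩ := Option.isSome_iff_exists.1 hsome
    rw [hk]
    have hk1 := List.find?_some hk
    have hk2 := List.mem_of_find?_eq_some hk
    simp only [Bool.not_eq_true', decide_eq_false_iff_not, List.mem_reverse, List.mem_range]
      at hk1 hk2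
    have hki := hmax k ((hmem k).2 ⟨hk2, hk1⟩)
    rw [List.find?_eq_some_iff_append] at hk
    obtain ⟨_, as, bs, hab, has⟩ := hk
    have hpw : ((List.range p.length).reverse).Pairwise (fun a b => b < a) := by
      rw [List.pairwise_reverse]
      exact List.pairwise_lt_range
    have him : i ∈ (List.range p.length).reverse := by simpa using hi1
    rw [hab] at hpw him
    rw [List.pairwise_append, List.pairwise_cons] at hpw
    simp only [List.mem_append, List.mem_cons] at him
    rcases him with h | h | h
    · have := has i h
      simp at this
      exact (hi2 this).elim
    · rw [h]
    · have := hpw.2.1.1 i h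
      omega
  · unfold s2 idxCount
    have : (Finset.range p.length).filter
        (fun i => IsLRMin p i ∧ ∀ j, j < p.length → ¬ IsLRMin p j → j < i)
        = Finset.Ico (i + 1) p.length := by
      ext k
      simp only [Finset.mem_filter, Finset.mem_range, Finset.mem_Ico]
      constructor
      · rintro ⟨h1, _, h3⟩
        exact ⟨h3 i hi1 hi2, h1⟩
      · rintro ⟨h1, h2⟩
        refine ⟨h2, ?_, ?_⟩
        · by_contra hc
          have := hmax k ((hmem k).2 ⟨h2, hc⟩)
          omega
        · intro j hj hj'
          have := hmax j ((hmem j).2 ⟨hj, hj'⟩)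
          omega
    rw [Finset.filter_congr_decidable]
    rw [this, Nat.card_Ico]
    omega

theorem ridPerm_no_bef (n : ℕ) (a b : ℕ) (h : Bef (ridPerm n) a b) : b < a := by
  obtain ⟨P, Q, D, h⟩ := bef_split h
  have hpw : (ridPerm n).Pairwise (fun a b => b < a) := by
    unfold ridPerm
    rw [List.pairwise_reverse]
    exact List.pairwise_lt_range'
  rw [h] at hpw
  simp only [List.pairwise_append] at hpw
  exact hpw.2.2 a (by simp) b (by simp)

theorem rid_allmin (n i : ℕ) (hi : i < (ridPerm n).length) : IsLRMin (ridPerm n) i := by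
  have hn : (ridPerm n).Nodup := by
    unfold ridPerm; rw [List.nodup_reverse]; exact List.nodup_range'
  rw [isLRMin_iff hn i hi]
  rintro ⟨a, ha, hb⟩
  have := ridPerm_no_bef n _ _ hb
  omega

theorem not_allmin {u q : List ℕ} (hu : u.Nodup) (ho : OrdIso q u)
    (h : ∀ i, i < q.length → IsLRMin q i) (e : ℕ) : ¬ NM u e := by
  intro he
  obtain ⟨i, hi, rfl⟩ := List.getElem_of_mem (nm_mem he)
  have hi' : i < q.length := by have := ho.1; omega
  exact (isLRMin_iff hu i hi).1 ((ordIso_lrmin ho i hi').1 (h i hi')) he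

theorem step_nm_left {u v : List ℕ} (h : Step u v) : (∃ e, NM u e) ∧ ∃ e, NM v e := by
  obtain ⟨P, Q, D, x, y, z, hx, hxy, hyz, rfl, rfl, hn⟩ := h
  exact ⟨⟨z, nm_mk (x := x) (by simp [hx]) (hxy.trans hyz)⟩,
    ⟨y, nm_mk (x := x) (by simp [hx]) hxy⟩⟩

theorem rid_isolated (n : ℕ) : Isolated pat123 pat1S2 (ridPerm n) := by
  intro σ _ h
  rcases Relation.ReflTransGen.cases_head h with h | ⟨τ, h, _⟩
  · exact h.symm
  · exfalso
    rcases h with h | h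
    · obtain ⟨u, v, hs, h1, h2⟩ := result_fwd h
      obtain ⟨⟨e, he⟩, _⟩ := step_nm_left hs
      have hn : u.Nodup := by obtain ⟨_, _, _, _, _, _, _, _, _, _, _, h⟩ := hs; exact h
      exact not_allmin hn h1 (rid_allmin n) e he
    · obtain ⟨u, v, hs, h1, h2⟩ := result_bwd h
      obtain ⟨_, ⟨e, he⟩⟩ := step_nm_left hs
      exact not_allmin hs.nodup_right h1 (rid_allmin n) e he

theorem reduce_perm {p : List ℕ} (hp : IsPermList p) (hm : HasNonMin p) :
    ∃ q, IsPermList q ∧ PermEquiv pat123 pat1S2 p q ∧ PermEquiv pat123 pat1S2 q p ∧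
      ∃ e, NM q e ∧ ∀ f, NM q f → f = e := by
  obtain ⟨v, hv, hev, e, he, hu⟩ := reduce p.length p le_rfl hp.nodup
    ((hasNonMin_iff hp.nodup).1 hm)
  have ho := stdize_ordIso v
  have hpv := stdize_perm hv
  have h1 := hev.1
  have h2 := hev.2
  rw [stdize_self hp] at h1 h2
  obtain ⟨i, hi, rfl⟩ := List.getElem_of_mem (nm_mem he)
  have tr : ∀ j (hj : j < v.length) (hj' : j < (stdize v).length),
      NM v v[j] ↔ NM (stdize v) (stdize v)[j] := by
    intro j hj hj'
    have := ordIso_lrmin ho j hj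
    rw [isLRMin_iff hv j hj, isLRMin_iff hpv.nodup j hj'] at this
    exact not_iff_not.1 this
  refine ⟨stdize v, hpv, h1, h2, (stdize v)[i]'(ho.1 ▸ hi), (tr i hi _).1 he, ?_⟩
  intro f hf
  obtain ⟨j, hj, rfl⟩ := List.getElem_of_mem (nm_mem hf)
  have hj' : j < v.length := by have := ho.1; omega
  have := hu _ ((tr j hj' hj).2 hf)
  have := (List.Nodup.getElem_inj_iff hv).1 this
  subst this
  rfl

end Helpers3

/-- under `123 ↔ 1★2`: (a) every reverse identity permutation is
isolated; (b) two permutations each having a non-left-to-right-minimum element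
are equivalent iff they agree in: the number of left-to-right minima, the
position counted from the right of the rightmost non-left-to-right-minimum
element, and the number of left-to-right minima smaller than the smallest
non-left-to-right-minimum element. -/
theorem classes_1star2 :
    (∀ n : ℕ, Isolated pat123 pat1S2 (ridPerm n)) ∧
    (∀ π σ : List ℕ, IsPermList π → IsPermList σ → HasNonMin π → HasNonMin σ →
      (PermEquiv pat123 pat1S2 π σ ↔
        numLRMin π = numLRMin σ ∧
        (∃ i j : ℕ, rightNonMin π = some i ∧ rightNonMin σ = some j ∧
          π.length - i = σ.length - j) ∧
        vStatMin π = vStatMin σ)) := by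
  refine ⟨rid_isolated, fun π σ hπ hσ hmπ hmσ => ?_⟩
  obtain ⟨i, hi, hi'⟩ := right_eq hmπ
  obtain ⟨j, hj, hj'⟩ := right_eq hmσ
  rw [numLRMin_eq, numLRMin_eq, vStatMin_eq hπ hmπ, vStatMin_eq hσ hmσ]
  constructor
  · intro h
    obtain ⟨e1, e2, e3⟩ := sameStat_of_equiv h
    exact ⟨e1, ⟨i, j, hi, hj, by omega⟩, e3⟩
  · rintro ⟨e1, ⟨i', j', hi2, hj2, e2⟩, e3⟩
    rw [hi] at hi2
    rw [hj] at hj2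
    cases hi2
    cases hj2
    have hs : SameStat π σ := ⟨e1, by omega, e3⟩
    obtain ⟨p, hp, p1, p2, e, he, heu⟩ := reduce_perm hπ hmπ
    obtain ⟨q, hq, q1, q2, f, hf, hfu⟩ := reduce_perm hσ hmσ
    have hpq : p = q := base_eq hp hq he heu hf hfu
      ((sameStat_of_equiv p2).trans (hs.trans (sameStat_of_equiv q1)))
    subst hpq
    exact Relation.ReflTransGen.trans p1 q2
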